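/- For every real number x with 0 < x < 1, ln(sin(πx)) = ln(πx) − ∑_{n=1}^{∞} (2·ζ(2)^{n}/((2n−1)·2n)) · (∑_{l=1}^{n} (−1)^{l+1} · C(n+2−l, 2) · P(l, n)) · x^{2n}, the series on the right converging. -/

import Mathlib

open Real

/-- Riordan's coefficients `a(n,l)`: `a(0,0) = 1`, `a(n,0) = 0` for `n ≥ 1`, and for `l ≥ 1`,
`a(n,l) = ∑_{i=l−1}^{n−1} a(i,l−1) · C(2n+l−1, 2n−2i)`. -/
def rio : ℕ → ℕ → ℚ
  | 0, 0 => 1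
  | _ + 1, 0 => 0
  | n, l + 1 => ∑ i ∈ Finset.Ico l n, rio i l * (Nat.choose (2 * n + l) (2 * n - 2 * i) : ℚ)

/-- The P-polynomial values `P(j,n) := 6^n · a(n, n+1−j) / ((2n)! · (n+1−j) · C(3n+1−j, 2n))`
(for `1 ≤ j ≤ n`). -/
def P (j n : ℕ) : ℚ :=
  6 ^ n * rio n (n + 1 - j) /
    ((Nat.factorial (2 * n) : ℚ) * ((n + 1 - j : ℕ) : ℚ) *
      (Nat.choose (3 * n + 1 - j) (2 * n) : ℚ))


namespace RioAux

open PowerSeries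

/-- The series `∑_{m≥1} X^m/(2m+1)!`, so that `sinh t / t - 1 = V(t^2)`. -/
noncomputable def vS : PowerSeries ℚ :=
  PowerSeries.mk fun m => if m = 0 then 0 else 1 / ((2 * m + 1).factorial : ℚ)

lemma coeff_X_mul_derivative (f : PowerSeries ℚ) (n : ℕ) :
    coeff n (X * derivative ℚ f) = n * coeff n f := by
  cases n with
  | zero => simp
  | succ n =>
    rw [coeff_succ_X_mul, coeff_derivative]
    push_cast
    ring

lemma vS_ode (l : ℕ) :
    (2 : PowerSeries ℚ) * (X * derivative ℚ (vS ^ (l + 1))) + ((l + 1 : ℕ) : PowerSeries ℚ) * vS ^ (l + 1)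
      = ((l + 1 : ℕ) : PowerSeries ℚ) * (vS ^ l * (2 * (X * derivative ℚ vS) + vS)) := by
  rw [derivative_pow]
  simp only [Nat.add_sub_cancel]
  ring

lemma coeff_nat_mul (k n : ℕ) (f : PowerSeries ℚ) :
    coeff n ((k : PowerSeries ℚ) * f) = k * coeff n f := by
  rw [← nsmul_eq_mul, map_nsmul, nsmul_eq_mul]

lemma vS_rec (l n : ℕ) :
    (2 * n + l + 1 : ℚ) * coeff n (vS ^ (l + 1)) =
      (l + 1) * ∑ p ∈ Finset.HasAntidiagonal.antidiagonal n, coeff p.1 (vS ^ l) *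
        (if p.2 = 0 then 0 else 1 / ((2 * p.2).factorial : ℚ)) := by
  have h := congrArg (coeff n) (vS_ode l)
  have h2 : (2 : PowerSeries ℚ) = ((2 : ℕ) : PowerSeries ℚ) := by norm_num
  rw [map_add, h2, coeff_nat_mul, coeff_nat_mul, coeff_nat_mul, coeff_X_mul_derivative,
    coeff_mul] at h
  have h3 : ∀ m, coeff m (((2 : ℕ) : PowerSeries ℚ) * (X * derivative ℚ vS) + vS) =
      (if m = 0 then 0 else 1 / ((2 * m).factorial : ℚ)) := by
    intro m
    rw [map_add, coeff_nat_mul, coeff_X_mul_derivative, vS, coeff_mk]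
    split_ifs with hm
    · simp
    · rw [Nat.factorial_succ]
      have : ((2 * m).factorial : ℚ) ≠ 0 := by positivity
      push_cast
      field_simp
  simp only [h3] at h
  push_cast at h
  linear_combination h

lemma coeff_vS_pow_of_lt {n l : ℕ} (h : n < l) : coeff n (vS ^ l) = 0 := by
  have h1 : (X : PowerSeries ℚ) ∣ vS := by
    rw [X_dvd_iff]
    simp [vS]
  exact (X_pow_dvd_iff.mp (pow_dvd_pow_of_dvd h1 l)) n h

lemma coeff_vS_pow (l : ℕ) : ∀ n, coeff n (vS ^ l) =
    l.factorial * rio n l / ((2 * n + l).factorial : ℚ) := by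
  induction l with
  | zero =>
    intro n
    cases n with
    | zero => simp [rio]
    | succ n => simp [rio, coeff_one]
  | succ l ih =>
    intro n
    have h := vS_rec l n
    have hr : rio n (l + 1) = ∑ i ∈ Finset.Ico l n,
        rio i l * (Nat.choose (2 * n + l) (2 * n - 2 * i) : ℚ) := by
      cases n <;> rw [rio]
    rw [Finset.Nat.sum_antidiagonal_eq_sum_range_succ_mk] at h
    have hs : ∑ k ∈ Finset.range n.succ, coeff k (vS ^ l) *
        (if n - k = 0 then 0 else 1 / ((2 * (n - k)).factorial : ℚ)) =
        ∑ i ∈ Finset.Ico l n, coeff i (vS ^ l) * (1 / ((2 * (n - i)).factorial : ℚ)) := by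
      symm
      apply Finset.sum_subset_zero_on_sdiff
      · intro i hi
        simp at hi ⊢
        omega
      · intro i hi
        simp only [Finset.mem_sdiff, Finset.mem_range, Finset.mem_Ico, not_and_or, not_le,
          not_lt] at hi
        rcases hi.2 with h1 | h1
        · rw [coeff_vS_pow_of_lt h1, zero_mul]
        · rw [if_pos (by omega), mul_zero]
      · intro i hi
        rw [Finset.mem_Ico] at hi
        rw [if_neg (by omega)]
    rw [hs] at h
    have ht : ∑ i ∈ Finset.Ico l n, coeff i (vS ^ l) * (1 / ((2 * (n - i)).factorial : ℚ)) =
        l.factorial * rio n (l + 1) / ((2 * n + l).factorial : ℚ) := by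
      rw [hr, Finset.mul_sum, Finset.sum_div]
      refine Finset.sum_congr rfl fun i hi => ?_
      rw [Finset.mem_Ico] at hi
      rw [ih, Nat.cast_choose ℚ (by omega : 2 * n - 2 * i ≤ 2 * n + l)]
      have e1 : 2 * n + l - (2 * n - 2 * i) = 2 * i + l := by omega
      have e2 : 2 * (n - i) = 2 * n - 2 * i := by omega
      rw [e1, e2]
      have := Nat.factorial_ne_zero (2 * n + l)
      field_simp
    rw [ht] at h
    have e3 : (2 * n + (l + 1)).factorial = (2 * n + l + 1) * (2 * n + l).factorial := by
      rw [← add_assoc, Nat.factorial_succ]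
    rw [e3, Nat.factorial_succ]
    have hp : (2 * n + l + 1 : ℚ) ≠ 0 := by positivity
    have hq : ((2 * n + l).factorial : ℚ) ≠ 0 := by positivity
    push_cast
    rw [eq_div_iff (by positivity)]
    rw [mul_div_assoc', eq_div_iff hq] at h
    linear_combination h

/-- The inverse of `(1 + vS)^2`. -/
noncomputable def gS : PowerSeries ℚ :=
  PowerSeries.mk fun n => 4 ^ n * (1 - 2 * n) * bernoulli (2 * n) / ((2 * n).factorial : ℚ)

lemma expand_vS : (2 : PowerSeries ℚ) * X * (1 + expand 2 two_ne_zero vS) =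
    exp ℚ - evalNegHom (exp ℚ) := by
  ext n
  have h2 : (2 : PowerSeries ℚ) = ((2 : ℕ) : PowerSeries ℚ) := by norm_num
  rw [mul_assoc, h2, coeff_nat_mul, map_sub, evalNegHom, coeff_rescale, coeff_exp]
  cases n with
  | zero => simp
  | succ n =>
    rw [coeff_succ_X_mul, map_add, coeff_expand, coeff_one]
    rcases Nat.even_or_odd' n with ⟨m, rfl | rfl⟩
    · rcases Nat.eq_zero_or_pos m with rfl | hm
      · simp [vS]; norm_num
      · have : m ≠ 0 := by omega
        simp [vS, pow_succ, this, pow_mul]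
        ring
    · have h : ¬ (2 ∣ 2 * m + 1) := by omega
      simp [h, pow_succ, pow_mul]

lemma bern_ode : bernoulliPowerSeries ℚ ^ 2 * exp ℚ =
    bernoulliPowerSeries ℚ - X * derivative ℚ (bernoulliPowerSeries ℚ) := by
  have h := bernoulliPowerSeries_mul_exp_sub_one ℚ
  have h' := congrArg (derivative ℚ) h
  rw [Derivation.leibniz, map_sub, derivative_exp, derivative_one, derivative_X] at h'
  simp only [smul_eq_mul, sub_zero] at h'
  linear_combination bernoulliPowerSeries ℚ * h' - derivative ℚ (bernoulliPowerSeries ℚ) * h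

lemma expand_gS : expand 2 two_ne_zero gS = rescale (2 : ℚ)
    (bernoulliPowerSeries ℚ - X * derivative ℚ (bernoulliPowerSeries ℚ)) := by
  ext n
  rw [coeff_rescale, map_sub, coeff_X_mul_derivative, coeff_expand, bernoulliPowerSeries, coeff_mk]
  rcases Nat.even_or_odd' n with ⟨m, rfl | rfl⟩
  · simp [gS, pow_mul]
    norm_num
    ring
  · have h : ¬ (2 ∣ 2 * m + 1) := by omega
    rw [if_neg h]
    rcases Nat.eq_zero_or_pos m with rfl | hm
    · simp
    · rw [bernoulli_eq_zero_of_odd ⟨m, rfl⟩ (by omega)]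
      simp

lemma gS_mul : gS * (1 + vS) ^ 2 = 1 := by
  have hb := congrArg (rescale (2 : ℚ)) (bernoulliPowerSeries_mul_exp_sub_one ℚ)
  have ho := congrArg (rescale (2 : ℚ)) bern_ode
  rw [← expand_gS] at ho
  have hE := exp_pow_eq_rescale_exp (A := ℚ) 2
  push_cast at hE
  have hX : rescale (2 : ℚ) (X : PowerSeries ℚ) = 2 * X := by
    rw [rescale_X]
    rfl
  rw [map_mul, map_pow, ← hE] at ho
  rw [map_mul, map_sub, map_one, ← hE, hX] at hb
  have hV := expand_vS
  have hn := exp_mul_exp_neg_eq_one (A := ℚ)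
  set R := rescale (2 : ℚ) (bernoulliPowerSeries ℚ)
  set W := expand 2 two_ne_zero vS
  have h1 : R * exp ℚ * (1 + W) = 1 := by
    have hne : (2 * X : PowerSeries ℚ) ≠ 0 := by
      refine mul_ne_zero (fun h0 => ?_) X_ne_zero
      have h00 := congrArg (constantCoeff (R := ℚ)) h0
      rw [map_ofNat, map_zero] at h00
      norm_num at h00
    apply mul_left_cancel₀ hne
    linear_combination R * exp ℚ * hV + hb - R * hn
  have h2 : expand 2 two_ne_zero (gS * (1 + vS) ^ 2) = 1 := by
    rw [map_mul, map_pow, map_add, map_one, ← ho]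
    linear_combination (R * exp ℚ * (1 + W) + 1) * h1
  ext n
  have h3 := congrArg (coeff (2 * n)) h2
  rw [coeff_expand_mul] at h3
  rw [h3, coeff_one, coeff_one]
  simp

lemma geom_sq (v : PowerSeries ℚ) (N : ℕ) :
    (1 + v) ^ 2 * ∑ k ∈ Finset.range N, (-1) ^ k * ((k + 1 : ℕ) : PowerSeries ℚ) * v ^ k =
      1 - (-1) ^ N * v ^ N * (((N + 1 : ℕ) : PowerSeries ℚ) + (N : PowerSeries ℚ) * v) := by
  induction N with
  | zero => simp
  | succ N ih =>
    rw [Finset.sum_range_succ, mul_add, ih]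
    push_cast
    ring

lemma sum_coeff (n : ℕ) :
    ∑ k ∈ Finset.range (n + 1), (-1 : ℚ) ^ k * (k + 1) * coeff n (vS ^ k) =
      4 ^ n * (1 - 2 * n) * bernoulli (2 * n) / ((2 * n).factorial : ℚ) := by
  have h := congrArg (fun s => gS * s) (geom_sq vS (n + 1))
  simp only [← mul_assoc] at h
  rw [gS_mul, one_mul] at h
  have h' := congrArg (coeff n) h
  have hz : coeff n (gS * (1 - (-1) ^ (n + 1) * vS ^ (n + 1) *
      (((n + 1 + 1 : ℕ) : PowerSeries ℚ) + ((n + 1 : ℕ) : PowerSeries ℚ) * vS))) = coeff n gS := by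
    rw [mul_sub, mul_one, map_sub, sub_eq_self]
    have h1 : (X : PowerSeries ℚ) ∣ vS := by
      rw [X_dvd_iff]
      simp [vS]
    have h2 := pow_dvd_pow_of_dvd h1 (n + 1)
    refine X_pow_dvd_iff.mp (h2.trans ?_) n (Nat.lt_succ_self n)
    exact ⟨gS * (-1) ^ (n + 1) * (((n + 1 + 1 : ℕ) : PowerSeries ℚ) +
      ((n + 1 : ℕ) : PowerSeries ℚ) * vS), by ring⟩
  rw [hz, map_sum, gS, coeff_mk] at h'
  rw [← h']
  refine Finset.sum_congr rfl fun k _ => ?_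
  have : ((-1) ^ k * ((k + 1 : ℕ) : PowerSeries ℚ) * vS ^ k) =
      C ((-1 : ℚ) ^ k * (k + 1)) * vS ^ k := by simp
  rw [this, coeff_C_mul]

lemma sum_P_eq (n : ℕ) (hn : 1 ≤ n) :
    ∑ l ∈ Finset.Icc 1 n, (-1 : ℚ) ^ (l + 1) * (Nat.choose (n + 2 - l) 2 : ℚ) * P l n =
      6 ^ n / 2 * (-1) ^ n *
        (4 ^ n * (1 - 2 * n) * bernoulli (2 * n) / ((2 * n).factorial : ℚ)) := by
  rw [← sum_coeff, Finset.sum_range_succ']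
  have h0 : coeff n (vS ^ 0) = 0 := by
    rw [pow_zero, coeff_one, if_neg (by omega)]
  rw [h0, mul_zero, add_zero, Finset.mul_sum, ← Finset.sum_range_reflect]
  rw [Finset.range_eq_Ico, Finset.sum_Ico_eq_sum_range, ← Finset.Ico_succ_right_eq_Icc,
    Finset.sum_Ico_eq_sum_range]
  simp only [Nat.succ_eq_succ, Nat.succ_eq_add_one, Nat.add_sub_cancel, Nat.sub_zero]
  refine Finset.sum_congr rfl fun j hj => ?_
  rw [Finset.mem_range] at hj
  obtain ⟨k, rfl⟩ : ∃ k, n = k + 1 + j := ⟨n - 1 - j, by omega⟩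
  have e1 : k + 1 + j - 1 - (0 + j) + 1 = k + 1 := by omega
  have e2 : k + 1 + j + 2 - (1 + j) = k + 2 := by omega
  have e3 : k + 1 + j + 1 - (1 + j) = k + 1 := by omega
  have e4 : 3 * (k + 1 + j) + 1 - (1 + j) = 2 * (k + 1 + j) + (k + 1) := by omega
  rw [e1, e2, P, e3, e4, coeff_vS_pow, Nat.cast_add_choose, Nat.cast_choose_two]
  have : ((2 * (k + 1 + j) + (k + 1)).factorial : ℚ) ≠ 0 := by positivity
  have : ((2 * (k + 1 + j)).factorial : ℚ) ≠ 0 := by positivity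
  have hk : ((k + 1).factorial : ℚ) ≠ 0 := by positivity
  have hs : (-1 : ℚ) ^ (k + 1 + j) * (-1) ^ (k + 1) = (-1) ^ (1 + j + 1) := by
    have : ((-1 : ℚ) ^ (k + 1)) * (-1) ^ (k + 1) = 1 := by
      rw [← mul_pow]; simp
    rw [pow_add (-1 : ℚ) (k + 1) j]
    linear_combination (-1 : ℚ) ^ j * this
  rw [← hs]
  push_cast
  field_simp
  ring

end RioAux

namespace RioAux

lemma hasSum_log_prod (x : ℝ) (hx0 : 0 < x) (hx1 : x < 1) :
    HasSum (fun j : ℕ => -Real.log (1 - x ^ 2 / ((j : ℝ) + 1) ^ 2))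
      (Real.log (Real.pi * x) - Real.log (Real.sin (Real.pi * x))) := by
  have hq : ∀ j : ℕ, 0 ≤ x ^ 2 / ((j : ℝ) + 1) ^ 2 ∧ x ^ 2 / ((j : ℝ) + 1) ^ 2 < 1 := by
    intro j
    refine ⟨by positivity, ?_⟩
    rw [div_lt_one (by positivity)]
    have : (0 : ℝ) ≤ j := Nat.cast_nonneg j
    nlinarith
  have hpx : 0 < Real.pi * x := mul_pos Real.pi_pos hx0
  have hs : 0 < Real.sin (Real.pi * x) :=
    Real.sin_pos_of_pos_of_lt_pi hpx (by nlinarith [Real.pi_pos])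
  rw [hasSum_iff_tendsto_nat_of_nonneg]
  · have h := (Real.tendsto_euler_sin_prod x).log hs.ne'
    have h2 := h.const_sub (Real.log (Real.pi * x))
    refine h2.congr fun n => ?_
    have hne : ∀ j ∈ Finset.range n, (1 : ℝ) - x ^ 2 / ((j : ℝ) + 1) ^ 2 ≠ 0 :=
      fun j _ => (sub_pos.mpr (hq j).2).ne'
    rw [Real.log_mul hpx.ne' (Finset.prod_ne_zero_iff.mpr hne), Real.log_prod hne,
      Finset.sum_neg_distrib]
    ring
  · intro j
    have := Real.log_nonpos (x := 1 - x ^ 2 / ((j : ℝ) + 1) ^ 2) (by linarith [(hq j).2])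
      (by linarith [(hq j).1])
    linarith

lemma hasSum_zeta_series (x : ℝ) (hx0 : 0 < x) (hx1 : x < 1) :
    HasSum (fun n : ℕ => ((-1 : ℝ) ^ (n + 1 + 1) * (2 : ℝ) ^ (2 * (n + 1) - 1) *
        Real.pi ^ (2 * (n + 1)) * bernoulli (2 * (n + 1)) / ((2 * (n + 1)).factorial : ℝ)) *
        (x ^ (2 * (n + 1)) / ((n : ℝ) + 1)))
      (Real.log (Real.pi * x) - Real.log (Real.sin (Real.pi * x))) := by
  have hq : ∀ j : ℕ, |x ^ 2 / ((j : ℝ) + 1) ^ 2| < 1 := by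
    intro j
    rw [abs_of_nonneg (by positivity), div_lt_one (by positivity)]
    have : (0 : ℝ) ≤ j := Nat.cast_nonneg j
    nlinarith
  have hL := hasSum_log_prod x hx0 hx1
  have hrow := fun j : ℕ => Real.hasSum_pow_div_log_of_abs_lt_one (hq j)
  let f : ℕ × ℕ → ℝ := fun p => (x ^ 2 / ((p.1 : ℝ) + 1) ^ 2) ^ (p.2 + 1) / ((p.2 : ℝ) + 1)
  have hf : Summable f := by
    rw [summable_prod_of_nonneg (fun p => by simp only [f, Pi.zero_apply]; positivity)]
    refine ⟨fun j => (hrow j).summable, ?_⟩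
    have : (fun j : ℕ => ∑' n, f (j, n)) =
        fun j : ℕ => -Real.log (1 - x ^ 2 / ((j : ℝ) + 1) ^ 2) :=
      funext fun j => (hrow j).tsum_eq
    rw [this]
    exact hL.summable
  have htot : HasSum f (Real.log (Real.pi * x) - Real.log (Real.sin (Real.pi * x))) := by
    have h1 := hf.hasSum.prod_fiberwise (fun j => hrow j)
    rw [← h1.unique hL]
    exact hf.hasSum
  have hsw := (Equiv.prodComm ℕ ℕ).hasSum_iff.mpr htot
  refine hsw.prod_fiberwise fun n => ?_
  have hz := hasSum_zeta_nat (k := n + 1) (Nat.succ_ne_zero n)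
  rw [← hasSum_nat_add_iff' 1] at hz
  simp only [Finset.sum_range_one, Nat.cast_zero] at hz
  rw [zero_pow (by omega), div_zero, sub_zero] at hz
  have h2 := hz.mul_right (x ^ (2 * (n + 1)) / ((n : ℝ) + 1))
  convert! h2 using 1
  funext j
  simp only [f, Function.comp, Equiv.prodComm_apply, Prod.swap_prod_mk]
  push_cast
  rw [div_pow, ← pow_mul, ← pow_mul]
  field_simp

end RioAux

/-- For every real `0 < x < 1`,
`ln(sin(πx)) = ln(πx) − ∑_{n=1}^{∞} (2·ζ(2)^n/((2n−1)·2n)) ·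
(∑_{l=1}^{n} (−1)^{l+1}·C(n+2−l,2)·P(l,n)) · x^{2n}`, the series converging.
(The series index `n ≥ 1` is realized as `n+1` for `n : ℕ`; `ζ(2)` is the — real — value
`(riemannZeta 2).re` of the Riemann zeta function at `2`.) -/
theorem log_sin_pi_mul_eq (x : ℝ) (hx0 : 0 < x) (hx1 : x < 1) :
    HasSum
      (fun n : ℕ =>
        (2 * ((riemannZeta 2).re) ^ (n + 1) / ((2 * ((n : ℝ) + 1) - 1) * (2 * ((n : ℝ) + 1)))) *
          (∑ l ∈ Finset.Icc 1 (n + 1),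
            (-1 : ℝ) ^ (l + 1) * (Nat.choose (n + 1 + 2 - l) 2 : ℝ) * ((P l (n + 1) : ℚ) : ℝ)) *
          x ^ (2 * (n + 1)))
      (Real.log (Real.pi * x) - Real.log (Real.sin (Real.pi * x))) := by
  have h := RioAux.hasSum_zeta_series x hx0 hx1
  convert! h using 1
  funext n
  have hS := congrArg (fun q : ℚ => (q : ℝ)) (RioAux.sum_P_eq (n + 1) (by omega))
  push_cast at hS
  have hz : (riemannZeta 2).re = Real.pi ^ 2 / 6 := by
    rw [riemannZeta_two]
    have : ((Real.pi : ℂ) ^ 2 / 6) = ((Real.pi ^ 2 / 6 : ℝ) : ℂ) := by push_cast; rfl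
    rw [this, Complex.ofReal_re]
  rw [hS, hz]
  have e : 2 * (n + 1) - 1 = 2 * n + 1 := by omega
  have hf : ((2 * (n + 1)).factorial : ℝ) ≠ 0 := by positivity
  have h1 : (2 * ((n : ℝ) + 1) - 1) ≠ 0 := by
    have : (0 : ℝ) ≤ n := Nat.cast_nonneg n
    linarith
  have h4 : (4 : ℝ) ^ (n + 1) = 2 * 2 ^ (2 * n + 1) := by
    rw [show (4 : ℝ) = 2 ^ 2 by norm_num, ← pow_mul]
    ring
  rw [e, h4, div_pow, ← pow_mul]
  field_simp
  ring
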